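/- (Conservation.) If u, h : ℤ^d → ℝ satisfy Σ_{α∈ℤ^d} |u_α| < ∞ and Σ_{α∈ℤ^d} |h_α| < ∞ and u solves one implicit step with data h, then Σ_{α∈ℤ^d} u_α = Σ_{α∈ℤ^d} h_α. -/

import Mathlib

open MeasureTheory Set

noncomputable section

abbrev Ed (d : ℕ) := EuclideanSpace ℝ (Fin d)

def cell (d : ℕ) (dx : ℝ) (α : Fin d → ℤ) : Set (Ed d) :=
  {x | ∀ i, dx * (α i : ℝ) < x i ∧ x i < dx * (α i : ℝ) + dx}

def ind (d : ℕ) (S : Set (Ed d)) : Ed d → ℝ :=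
  S.indicator fun _ => 1

def gam (d : ℕ) (dx : ℝ) (μ : Measure (Ed d)) (l : Fin d) : ℝ :=
  - ∫ z in {z : Ed d | dx / 2 < ‖z‖ ∧ ‖z‖ ≤ 1}, z l ∂μ

def Dup (d : ℕ) (dx : ℝ) (μ : Measure (Ed d)) (l : Fin d) (φ : Ed d → ℝ) (x : Ed d) : ℝ :=
  if 0 < gam d dx μ l then (φ (x + EuclideanSpace.single l dx) - φ x) / dx
  else (φ x - φ (x - EuclideanSpace.single l dx)) / dx

def Glow (d : ℕ) (dx : ℝ) (μ : Measure (Ed d)) (α β : Fin d → ℤ) : ℝ :=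
  (dx ^ d)⁻¹ *
    ∫ x in cell d dx α, ∫ z in {z : Ed d | dx / 2 < ‖z‖},
      (ind d (cell d dx β) (x + z) - ind d (cell d dx β) x) ∂μ

def Gup (d : ℕ) (dx : ℝ) (μ : Measure (Ed d)) (α β : Fin d → ℤ) : ℝ :=
  (dx ^ d)⁻¹ *
    ∑ l : Fin d, gam d dx μ l * ∫ x in cell d dx α, Dup d dx μ l (ind d (cell d dx β)) x

def Gw (d : ℕ) (dx : ℝ) (μ : Measure (Ed d)) (α β : Fin d → ℤ) : ℝ :=
  Glow d dx μ α β + Gup d dx μ α β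

def GsplitLow (d : ℕ) (dx r : ℝ) (μ : Measure (Ed d)) (α β : Fin d → ℤ) : ℝ :=
  (dx ^ d)⁻¹ *
    ∫ x in cell d dx α, ∫ z in {z : Ed d | dx / 2 < ‖z‖ ∧ ‖z‖ ≤ r},
      (ind d (cell d dx β) (x + z) - ind d (cell d dx β) x) ∂μ

def GsplitHigh (d : ℕ) (dx r : ℝ) (μ : Measure (Ed d)) (α β : Fin d → ℤ) : ℝ :=
  (dx ^ d)⁻¹ *
      ∫ x in cell d dx α, ∫ z in {z : Ed d | r < ‖z‖},
        (ind d (cell d dx β) (x + z) - ind d (cell d dx β) x) ∂μ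
    + Gup d dx μ α β

def Aok (A : ℝ → ℝ) (LA : ℝ) : Prop :=
  Monotone A ∧ (∀ a b : ℝ, |A a - A b| ≤ LA * |a - b|) ∧ A 0 = 0

def SolvesImplicitStep (d : ℕ) (dx : ℝ) (μ : Measure (Ed d)) (A : ℝ → ℝ) (dt : ℝ)
    (u h : (Fin d → ℤ) → ℝ) : Prop :=
  ∀ α, Summable (fun β => Gw d dx μ α β * A (u β)) ∧
    u α - dt * ∑' β, Gw d dx μ α β * A (u β) = h α

def Fractional (d : ℕ) (μ : Measure (Ed d)) (lam clam : ℝ) : Prop :=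
  ∀ B : Set (Ed d), MeasurableSet B → B ⊆ {z : Ed d | 0 < ‖z‖ ∧ ‖z‖ < 1} →
    μ B ≤ ∫⁻ z in B, ENNReal.ofReal (clam * ‖z‖ ^ (-(d : ℝ) - lam))

def Lhat (d : ℕ) (dx : ℝ) (μ : Measure (Ed d)) (w : Ed d → ℝ) (x : Ed d) : ℝ :=
  (∫ z in {z : Ed d | dx / 2 < ‖z‖}, (w (x + z) - w x) ∂μ) +
    ∑ l : Fin d, gam d dx μ l * Dup d dx μ l w x

def Ubar (d : ℕ) (dx : ℝ) (U : (Fin d → ℤ) → ℝ) (x : Ed d) : ℝ :=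
  ∑' α : Fin d → ℤ, U α * ind d (cell d dx α) x

def cellAvg (d : ℕ) (dx : ℝ) (w : Ed d → ℝ) (x : Ed d) : ℝ :=
  ∑' α : Fin d → ℤ, Set.indicator (cell d dx α)
    (fun _ => (dx ^ d)⁻¹ * ∫ y in cell d dx α, w y) x


theorem measurableSet_cell (d : ℕ) (dx : ℝ) (α : Fin d → ℤ) : MeasurableSet (cell d dx α) := by
  have h : cell d dx α = ⋂ i, {x : Ed d | dx * (α i : ℝ) < x i ∧ x i < dx * (α i : ℝ) + dx} := by
    ext x
    simp [cell]
  rw [h]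
  refine MeasurableSet.iInter fun i => ?_
  have hx : Measurable fun x : Ed d => x i := by fun_prop
  exact (measurableSet_lt measurable_const hx).inter (measurableSet_lt hx measurable_const)

theorem volume_cell_lt_top (d : ℕ) (dx : ℝ) (α : Fin d → ℤ) : volume (cell d dx α) < ⊤ := by
  have h : cell d dx α = WithLp.ofLp ⁻¹'
      (Set.univ.pi fun i => Ioo (dx * (α i : ℝ)) (dx * (α i : ℝ) + dx)) := by
    ext x
    simp [cell]
  rw [h, (PiLp.volume_preserving_ofLp (Fin d)).measure_preimage
    (MeasurableSet.univ_pi fun i => measurableSet_Ioo).nullMeasurableSet, Real.volume_pi_Ioo]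
  exact ENNReal.prod_lt_top fun i _ => ENNReal.ofReal_lt_top

theorem pairwise_disjoint_cell (d : ℕ) {dx : ℝ} (hdx : 0 < dx) :
    Pairwise (Function.onFun Disjoint (cell d dx)) := by
  intro α β hαβ
  rw [Function.onFun, Set.disjoint_left]
  intro x hα hβ
  refine hαβ (funext fun i => ?_)
  have key : ∀ m n : ℤ, dx * (m : ℝ) < dx * (n : ℝ) + dx → m ≤ n := by
    intro m n h
    have h' : (m : ℝ) < (n : ℝ) + 1 := by
      refine lt_of_mul_lt_mul_left ?_ hdx.le
      linarith
    exact Int.lt_add_one_iff.mp (by exact_mod_cast h')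
  exact le_antisymm (key _ _ ((hα i).1.trans (hβ i).2)) (key _ _ ((hβ i).1.trans (hα i).2))

theorem iUnion_cell_ae_eq_univ (d : ℕ) {dx : ℝ} (hdx : 0 < dx) :
    (⋃ α, cell d dx α) =ᵐ[volume] (Set.univ : Set (Ed d)) := by
  have hne : ∀ᵐ x : Ed d, ∀ (i : Fin d) (k : ℤ), x i ≠ dx * (k : ℝ) := by
    rw [ae_all_iff]
    intro i
    rw [ae_all_iff]
    intro k
    exact (PiLp.volume_preserving_ofLp (Fin d)).quasiMeasurePreserving.ae
      (Measure.ae_eval_ne (μ := fun _ : Fin d => (volume : Measure ℝ)) i (dx * (k : ℝ)))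
  rw [ae_eq_univ]
  refine measure_mono_null ?_ (ae_iff.mp hne)
  intro x hx hx'
  refine hx (mem_iUnion.mpr ⟨fun i => ⌊x i / dx⌋, fun i => ⟨?_, ?_⟩⟩)
  · refine lt_of_le_of_ne ?_ (hx' i _).symm
    rw [mul_comm]
    exact (le_div_iff₀ hdx).mp (Int.floor_le _)
  · have h := (div_lt_iff₀ hdx).mp (Int.lt_floor_add_one (x i / dx))
    linarith

theorem hasSum_setIntegral_cell (d : ℕ) {dx : ℝ} (hdx : 0 < dx) {F : Ed d → ℝ}
    (hF : Integrable F) : HasSum (fun α => ∫ x in cell d dx α, F x) (∫ x, F x) := by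
  have h := hasSum_integral_iUnion (measurableSet_cell d dx) (pairwise_disjoint_cell d hdx)
    hF.integrableOn
  rwa [setIntegral_congr_set (iUnion_cell_ae_eq_univ d hdx), setIntegral_univ] at h

theorem integrable_ind_cell (d : ℕ) (dx : ℝ) (α : Fin d → ℤ) :
    Integrable (ind d (cell d dx α)) :=
  (integrable_indicator_iff (measurableSet_cell d dx α)).mpr
    (integrableOn_const (volume_cell_lt_top d dx α).ne)

theorem ind_cell_eq (d : ℕ) (dx : ℝ) (α : Fin d → ℤ) (x : Ed d) :
    ind d (cell d dx α) x =
      ind d (cell d dx 0) (x - WithLp.toLp 2 fun i => dx * (α i : ℝ)) := by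
  have h : x ∈ cell d dx α ↔ x - WithLp.toLp 2 (fun i => dx * (α i : ℝ)) ∈ cell d dx 0 := by
    simp only [cell, mem_ofPred_eq, PiLp.sub_apply, Pi.zero_apply, Int.cast_zero, mul_zero,
      zero_add, sub_pos, sub_lt_iff_lt_add']
  unfold ind
  by_cases hx : x ∈ cell d dx α
  · rw [indicator_of_mem hx, indicator_of_mem (h.mp hx)]
  · rw [indicator_of_notMem hx, indicator_of_notMem (mt h.mpr hx)]

theorem Lhat_comp_sub (d : ℕ) (dx : ℝ) (μ : Measure (Ed d)) (w : Ed d → ℝ) (c x : Ed d) :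
    Lhat d dx μ (fun y => w (y - c)) x = Lhat d dx μ w (x - c) := by
  simp only [Lhat, Dup, add_sub_right_comm _ _ c, sub_right_comm _ _ c]

theorem measure_norm_gt_lt_top (d : ℕ) {dx : ℝ} (hdx : 0 < dx) {μ : Measure (Ed d)}
    (hμ : ∫⁻ z, ENNReal.ofReal (min (‖z‖ ^ 2) 1) ∂μ < ⊤) :
    μ {z : Ed d | dx / 2 < ‖z‖} < ⊤ := by
  set ε : ENNReal := ENNReal.ofReal (min ((dx / 2) ^ 2) 1) with hε
  have hε0 : ε ≠ 0 := by
    rw [hε, Ne, ENNReal.ofReal_eq_zero, not_le]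
    positivity
  have h := mul_meas_ge_le_lintegral (μ := μ)
    (f := fun z : Ed d => ENNReal.ofReal (min (‖z‖ ^ 2) 1)) (by fun_prop) ε
  refine lt_of_le_of_lt (measure_mono fun z hz => ?_)
    (ENNReal.lt_top_of_mul_ne_top_right (h.trans_lt hμ).ne hε0)
  have hz' : dx / 2 < ‖z‖ := hz
  exact ENNReal.ofReal_le_ofReal (by gcongr)

section Increments

variable {d : ℕ} {ν : Measure (Ed d)} [IsFiniteMeasure ν] {w : Ed d → ℝ}

theorem integrable_prod_increment (hw : Integrable w) :
    Integrable (fun p : Ed d × Ed d => w (p.2 + p.1) - w p.2) (ν.prod volume) := by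
  refine Integrable.sub ?_ (hw.comp_snd ν)
  have h := (measurePreserving_prod_add ν (volume : Measure (Ed d))).integrable_comp_of_integrable
    (hw.comp_snd ν)
  simpa only [Function.comp_def, add_comm] using h

theorem integrable_integral_increment (hw : Integrable w) :
    Integrable fun x => ∫ z, (w (x + z) - w x) ∂ν :=
  (integrable_prod_increment hw).integral_prod_right

theorem integral_integral_increment (hw : Integrable w) :
    ∫ x, ∫ z, (w (x + z) - w x) ∂ν = 0 := by
  rw [← integral_integral_swap (f := fun z x => w (x + z) - w x)
    (integrable_prod_increment hw)]
  have h : ∀ z, ∫ x, (w (x + z) - w x) = 0 := fun z => by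
    rw [integral_sub (hw.comp_add_right z) hw, integral_add_right_eq_self, sub_self]
  simp [h]

end Increments

section UpwindDifference

variable {d : ℕ} (dx : ℝ) (μ : Measure (Ed d)) (l : Fin d) {w : Ed d → ℝ}

theorem integrable_Dup (hw : Integrable w) : Integrable (Dup d dx μ l w) := by
  unfold Dup
  split_ifs
  · exact ((hw.comp_add_right _).sub hw).div_const dx
  · exact (hw.sub (hw.comp_sub_right _)).div_const dx

theorem integral_Dup (hw : Integrable w) : ∫ x, Dup d dx μ l w x = 0 := by
  unfold Dup
  split_ifs
  · rw [integral_div, integral_sub (hw.comp_add_right _) hw, integral_add_right_eq_self, sub_self,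
      zero_div]
  · rw [integral_div, integral_sub hw (hw.comp_sub_right _), integral_sub_right_eq_self, sub_self,
      zero_div]

end UpwindDifference

section Operator

variable {d : ℕ} {dx : ℝ} (hdx : 0 < dx) {μ : Measure (Ed d)}
  (hμ : ∫⁻ z, ENNReal.ofReal (min (‖z‖ ^ 2) 1) ∂μ < ⊤) {w : Ed d → ℝ}

include hdx hμ

theorem integrable_far_increment (hw : Integrable w) :
    Integrable fun x => ∫ z in {z : Ed d | dx / 2 < ‖z‖}, (w (x + z) - w x) ∂μ :=
  have : IsFiniteMeasure (μ.restrict {z : Ed d | dx / 2 < ‖z‖}) :=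
    isFiniteMeasure_restrict.mpr (measure_norm_gt_lt_top d hdx hμ).ne
  integrable_integral_increment hw

theorem integrable_Lhat (hw : Integrable w) : Integrable (Lhat d dx μ w) :=
  (integrable_far_increment hdx hμ hw).add
    (integrable_finsetSum _ fun l _ => (integrable_Dup dx μ l hw).const_mul _)

theorem integral_Lhat (hw : Integrable w) : ∫ x, Lhat d dx μ w x = 0 := by
  have : IsFiniteMeasure (μ.restrict {z : Ed d | dx / 2 < ‖z‖}) :=
    isFiniteMeasure_restrict.mpr (measure_norm_gt_lt_top d hdx hμ).ne
  unfold Lhat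
  rw [integral_add (integrable_far_increment hdx hμ hw)
      (integrable_finsetSum _ fun l _ => (integrable_Dup dx μ l hw).const_mul _),
    integral_integral_increment hw,
    integral_finsetSum _ fun l _ => (integrable_Dup dx μ l hw).const_mul _]
  simp [integral_const_mul, integral_Dup dx μ _ hw]

theorem Gw_eq_setIntegral_Lhat (α β : Fin d → ℤ) :
    Gw d dx μ α β =
      (dx ^ d)⁻¹ * ∫ x in cell d dx α, Lhat d dx μ (ind d (cell d dx β)) x := by
  have hw := integrable_ind_cell d dx β
  unfold Gw Glow Gup Lhat
  rw [integral_add (integrable_far_increment hdx hμ hw).integrableOn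
      (integrable_finsetSum _ fun l _ => (integrable_Dup dx μ l hw).const_mul _).integrableOn,
    integral_finsetSum _ fun l _ => ((integrable_Dup dx μ l hw).const_mul _).integrableOn]
  simp only [integral_const_mul, mul_add]

theorem hasSum_Gw (β : Fin d → ℤ) : HasSum (fun α => Gw d dx μ α β) 0 := by
  have hw := integrable_ind_cell d dx β
  have h := (hasSum_setIntegral_cell d hdx (integrable_Lhat hdx hμ hw)).mul_left (dx ^ d)⁻¹
  rw [integral_Lhat hdx hμ hw, mul_zero] at h
  simpa only [Gw_eq_setIntegral_Lhat hdx hμ] using h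

theorem summable_tsum_abs_Gw_le (β : Fin d → ℤ) :
    Summable (fun α => |Gw d dx μ α β|) ∧
      ∑' α, |Gw d dx μ α β| ≤ (dx ^ d)⁻¹ * ∫ x, |Lhat d dx μ (ind d (cell d dx 0)) x| := by
  have hw := integrable_ind_cell d dx β
  have hnorm : ∫ x, |Lhat d dx μ (ind d (cell d dx β)) x| =
      ∫ x, |Lhat d dx μ (ind d (cell d dx 0)) x| := by
    simp only [funext (ind_cell_eq d dx β), Lhat_comp_sub]
    exact integral_sub_right_eq_self (fun x => |Lhat d dx μ (ind d (cell d dx 0)) x|) _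
  have h := (hasSum_setIntegral_cell d hdx (integrable_Lhat hdx hμ hw).abs).mul_left (dx ^ d)⁻¹
  rw [hnorm] at h
  have hle : ∀ α, |Gw d dx μ α β| ≤
      (dx ^ d)⁻¹ * ∫ x in cell d dx α, |Lhat d dx μ (ind d (cell d dx β)) x| := fun α => by
    rw [Gw_eq_setIntegral_Lhat hdx hμ, abs_mul, abs_of_nonneg (by positivity : 0 ≤ (dx ^ d)⁻¹)]
    gcongr
    exact abs_integral_le_integral_abs
  have hs : Summable fun α => |Gw d dx μ α β| :=
    Summable.of_nonneg_of_le (fun _ => abs_nonneg _) hle h.summable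
  exact ⟨hs, h.tsum_eq ▸ hs.tsum_le_tsum hle h.summable⟩

theorem summable_Gw_mul {v : (Fin d → ℤ) → ℝ} (hv : Summable fun β => |v β|) :
    Summable fun p : (Fin d → ℤ) × (Fin d → ℤ) => Gw d dx μ p.2 p.1 * v p.1 := by
  refine Summable.of_norm ((summable_prod_of_nonneg fun _ => norm_nonneg _).mpr ⟨fun β => ?_, ?_⟩)
  · simp only [Real.norm_eq_abs, abs_mul]
    exact (summable_tsum_abs_Gw_le hdx hμ β).1.mul_right _
  · simp only [Real.norm_eq_abs, abs_mul, tsum_mul_right]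
    exact Summable.of_nonneg_of_le
      (fun β => mul_nonneg (tsum_nonneg fun _ => abs_nonneg _) (abs_nonneg _))
      (fun β => mul_le_mul_of_nonneg_right (summable_tsum_abs_Gw_le hdx hμ β).2 (abs_nonneg _))
      (hv.mul_left _)

theorem hasSum_tsum_Gw_mul {v : (Fin d → ℤ) → ℝ} (hv : Summable fun β => |v β|) :
    HasSum (fun α => ∑' β, Gw d dx μ α β * v β) 0 := by
  have hs := summable_Gw_mul hdx hμ hv
  have h0 : ∑' α, ∑' β, Gw d dx μ α β * v β = 0 := by
    rw [Summable.tsum_comm (f := fun β α => Gw d dx μ α β * v β) hs]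
    simp [tsum_mul_right, (hasSum_Gw hdx hμ _).tsum_eq]
  exact h0 ▸ hs.prod_symm.prod.hasSum

end Operator

theorem stmt6 (d : ℕ) (hd : 1 ≤ d) (dx : ℝ) (hdx0 : 0 < dx) (hdx1 : dx < 1)
    (μ : Measure (Ed d)) (hμ0 : μ {0} = 0)
    (hμfin : ∫⁻ z, ENNReal.ofReal (min (‖z‖ ^ 2) 1) ∂μ < ⊤)
    (A : ℝ → ℝ) (LA : ℝ) (hA : Aok A LA) (dt : ℝ) (hdt : 0 < dt)
    (u h : (Fin d → ℤ) → ℝ)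
    (hu : Summable fun α => |u α|) (hh : Summable fun α => |h α|)
    (hstep : SolvesImplicitStep d dx μ A dt u h) :
    ∑' α : Fin d → ℤ, u α = ∑' α : Fin d → ℤ, h α := by
  obtain ⟨-, hLip, hA0⟩ := hA
  have hAu : Summable fun β => |A (u β)| :=
    Summable.of_nonneg_of_le (fun _ => abs_nonneg _)
      (fun β => by simpa [hA0] using hLip (u β) 0) (hu.mul_left LA)
  have h := hu.of_abs.hasSum.sub ((hasSum_tsum_Gw_mul hdx0 hμfin hAu).mul_left dt)
  rw [mul_zero, sub_zero] at h
  simp only [fun α => (hstep α).2] at h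
  exact h.tsum_eq.symm
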